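/- (KL bound between two conditional Bernoulli classification models.) Let P_X be a probability measure on 𝒳 and let η₀, η₁ : 𝒳 → (0,1) be measurable. Write h_j(x) = log(η_j(x)/(1−η_j(x))) for j = 0,1. Then ∫ [ η₁(x) log( η₁(x)/η₀(x) ) + (1−η₁(x)) log( (1−η₁(x))/(1−η₀(x)) ) ] dP_X(x) ≤ (1/8) ∫ ( h₁(x) − h₀(x) )² dP_X(x). In particular, if P_j denotes the law on 𝒳 × {−1,1} of (X,Y) with X ∼ P_X and P(Y=1|X=x) = η_j(x), then KL(P₁, P₀) ≤ (1/8)‖h₁ − h₀‖²_{2,P_X}. -/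

import Mathlib

open MeasureTheory
open scoped ENNReal Classical

noncomputable section

namespace PB

/-- Kullback–Leibler divergence `KL(ν, μ) = ∫ log(dν/dμ) dν` if `ν ≪ μ` (with value `⊤`
when the integral is `+∞`), and `⊤` if `ν` is not absolutely continuous w.r.t. `μ`. -/
def KLdiv {E : Type*} [MeasurableSpace E] (ν μ : Measure E) : EReal :=
  if ν ≪ μ ∧ Integrable (fun x => Real.log ((ν.rnDeriv μ x).toReal)) ν then
    ((∫ x, Real.log ((ν.rnDeriv μ x).toReal) ∂ν : ℝ) : EReal)
  else ⊤

/-- the law on `𝒳 × {-1,1}` of `(X, Y)` with `X ∼ P_X` and `P(Y = 1 | X = x) = η(x)`. -/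
def bernoulliModel {𝒳 : Type*} [MeasurableSpace 𝒳] (PX : Measure 𝒳) (η : 𝒳 → ℝ) :
    Measure (𝒳 × ℝ) :=
  PX.bind fun x => ENNReal.ofReal (η x) • Measure.dirac (x, (1 : ℝ)) +
    ENNReal.ofReal (1 - η x) • Measure.dirac (x, (-1 : ℝ))

theorem hoeffding_aux (p u : ℝ) (hp : p ∈ Set.Ioo (0 : ℝ) 1) :
    Real.log (1 - p + p * Real.exp u) - p * u ≤ u ^ 2 / 8 := by
  obtain ⟨h0, h1⟩ := hp
  let μ : Measure ℝ := ENNReal.ofReal p • Measure.dirac 1 + ENNReal.ofReal (1 - p) • Measure.dirac 0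
  have hint : ∀ f : ℝ → ℝ, ∫ x, f x ∂μ = p * f 1 + (1 - p) * f 0 := by
    intro f
    have hi : ∀ a c : ℝ, Integrable f (ENNReal.ofReal c • Measure.dirac a) := fun a c =>
      (integrable_dirac (by simp)).smul_measure (by simp)
    rw [integral_add_measure (hi _ _) (hi _ _)]
    simp [integral_smul_measure, h0.le, h1.le]
  have hprob : IsProbabilityMeasure μ := by
    constructor
    simp only [μ, Measure.add_apply, Measure.smul_apply, measure_univ, smul_eq_mul, mul_one]
    rw [← ENNReal.ofReal_add h0.le (by linarith)]
    simp
  have hb : ∀ᵐ x ∂μ, (id x : ℝ) ∈ Set.Icc (0 : ℝ) 1 := by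
    rw [ae_iff]
    have : MeasurableSet {a : ℝ | ¬ id a ∈ Set.Icc (0 : ℝ) 1} := measurableSet_Icc.compl
    simp [μ, Measure.add_apply, Measure.smul_apply]
  have hs := (ProbabilityTheory.hasSubgaussianMGF_of_mem_Icc (μ := μ) aemeasurable_id hb).mgf_le u
  rw [ProbabilityTheory.mgf, hint, hint] at hs
  have hpos : 0 < 1 - p + p * Real.exp u := by have := Real.exp_pos u; nlinarith
  have key : 1 - p + p * Real.exp u ≤ Real.exp (u ^ 2 / 8 + p * u) := by
    have e : 1 - p + p * Real.exp u = Real.exp (p * u) *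
      (p * Real.exp (u * (1 - p)) + (1 - p) * Real.exp (u * (0 - p))) := by
      have e1 : Real.exp (u * (1 - p)) = Real.exp u * (Real.exp (p * u))⁻¹ := by
        rw [← Real.exp_neg, ← Real.exp_add]; ring_nf
      have e2 : Real.exp (u * (0 - p)) = (Real.exp (p * u))⁻¹ := by
        rw [← Real.exp_neg]; ring_nf
      rw [e1, e2]
      have := Real.exp_pos (p * u)
      field_simp
      ring
    rw [e, add_comm (u ^ 2 / 8), Real.exp_add]
    refine mul_le_mul_of_nonneg_left ?_ (Real.exp_pos _).le
    norm_num at hs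
    norm_num
    rw [show u ^ 2 / 8 = 1 / 4 * u ^ 2 / 2 by ring]
    exact hs
  have := Real.log_le_log hpos key
  rw [Real.log_exp] at this
  linarith

theorem pointwise_aux (p q : ℝ) (hp : p ∈ Set.Ioo (0 : ℝ) 1) (hq : q ∈ Set.Ioo (0 : ℝ) 1) :
    p * Real.log (p / q) + (1 - p) * Real.log ((1 - p) / (1 - q)) ≤
      1 / 8 * (Real.log (p / (1 - p)) - Real.log (q / (1 - q))) ^ 2 := by
  have h := hoeffding_aux p (Real.log (q / (1 - q)) - Real.log (p / (1 - p))) hp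
  obtain ⟨p0, p1⟩ := hp
  obtain ⟨q0, q1⟩ := hq
  have p1' : 0 < 1 - p := by linarith
  have q1' : 0 < 1 - q := by linarith
  rw [Real.exp_sub, Real.exp_log (by positivity), Real.exp_log (by positivity)] at h
  have e : 1 - p + p * (q / (1 - q) / (p / (1 - p))) = (1 - p) / (1 - q) := by
    field_simp
    ring
  rw [e] at h
  rw [Real.log_div p0.ne' p1'.ne', Real.log_div q0.ne' q1'.ne', Real.log_div p1'.ne' q1'.ne'] at *
  rw [Real.log_div p0.ne' q0.ne']
  nlinarith

theorem abs_log_aux (p q : ℝ) (hp : p ∈ Set.Ioo (0 : ℝ) 1) (hq : q ∈ Set.Ioo (0 : ℝ) 1) :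
    |Real.log (p / q)| ≤ |Real.log (p / (1 - p)) - Real.log (q / (1 - q))| ∧
    |Real.log ((1 - p) / (1 - q))| ≤ |Real.log (p / (1 - p)) - Real.log (q / (1 - q))| := by
  obtain ⟨p0, p1⟩ := hp
  obtain ⟨q0, q1⟩ := hq
  have p1' : 0 < 1 - p := by linarith
  have q1' : 0 < 1 - q := by linarith
  rw [Real.log_div p0.ne' p1'.ne', Real.log_div q0.ne' q1'.ne', Real.log_div p1'.ne' q1'.ne',
    Real.log_div p0.ne' q0.ne']
  rcases le_total p q with h | h
  · have a := Real.log_le_log p0 h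
    have b := Real.log_le_log q1' (by linarith : 1 - q ≤ 1 - p)
    rw [abs_of_nonpos (by linarith), abs_of_nonpos (by linarith), abs_of_nonneg (by linarith)]
    constructor <;> linarith
  · have a := Real.log_le_log q0 h
    have b := Real.log_le_log p1' (by linarith : 1 - p ≤ 1 - q)
    rw [abs_of_nonneg (by linarith), abs_of_nonneg (by linarith), abs_of_nonpos (by linarith)]
    constructor <;> linarith

theorem lintegral_model {𝒳 : Type*} [MeasurableSpace 𝒳] (PX : Measure 𝒳) (η : 𝒳 → ℝ)
    (hη : Measurable η) (f : 𝒳 × ℝ → ℝ≥0∞) (hf : Measurable f) :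
    ∫⁻ z, f z ∂(bernoulliModel PX η) =
      ∫⁻ x, (ENNReal.ofReal (η x) * f (x, 1) + ENNReal.ofReal (1 - η x) * f (x, -1)) ∂PX := by
  unfold bernoulliModel
  rw [Measure.lintegral_bind _ hf.aemeasurable]
  · refine lintegral_congr fun x => ?_
    rw [lintegral_add_measure, lintegral_smul_measure, lintegral_smul_measure,
      lintegral_dirac' _ hf, lintegral_dirac' _ hf]
    rfl
  · refine Measurable.aemeasurable (Measure.measurable_of_measurable_coe _ fun s hs => ?_)
    simp only [Measure.add_apply, Measure.smul_apply, smul_eq_mul, Measure.dirac_apply' _ hs]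
    have h1 : Measurable fun x : 𝒳 => s.indicator (1 : 𝒳 × ℝ → ℝ≥0∞) (x, (1 : ℝ)) :=
      (measurable_one.indicator hs).comp (by fun_prop)
    have h2 : Measurable fun x : 𝒳 => s.indicator (1 : 𝒳 × ℝ → ℝ≥0∞) (x, (-1 : ℝ)) :=
      (measurable_one.indicator hs).comp (by fun_prop)
    fun_prop

theorem model_finite {𝒳 : Type*} [MeasurableSpace 𝒳] (PX : Measure 𝒳) [IsProbabilityMeasure PX]
    (η : 𝒳 → ℝ) (hη : Measurable η) (h : ∀ x, η x ∈ Set.Ioo (0 : ℝ) 1) :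
    IsProbabilityMeasure (bernoulliModel PX η) := by
  constructor
  rw [← lintegral_one, lintegral_model PX η hη _ measurable_const]
  refine Eq.trans (lintegral_congr (g := fun _ => 1) fun x => ?_) (by simp)
  have := h x
  rw [mul_one, mul_one, ← ENNReal.ofReal_add this.1.le (by linarith [this.2])]
  simp

theorem model_eq {𝒳 : Type*} [MeasurableSpace 𝒳] (PX : Measure 𝒳) (η : 𝒳 → ℝ)
    (hη : Measurable η) :
    bernoulliModel PX η = (PX.withDensity fun x => ENNReal.ofReal (η x)).map (fun x => (x, (1 : ℝ)))
      + (PX.withDensity fun x => ENNReal.ofReal (1 - η x)).map (fun x => (x, (-1 : ℝ))) := by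
  refine Measure.ext_of_lintegral _ fun f hf => ?_
  rw [lintegral_model PX η hη f hf, lintegral_add_measure, lintegral_map hf (by fun_prop),
    lintegral_map hf (by fun_prop), lintegral_withDensity_eq_lintegral_mul _ (by fun_prop)
      (by fun_prop), lintegral_withDensity_eq_lintegral_mul _ (by fun_prop) (by fun_prop),
    ← lintegral_add_left (by fun_prop)]
  rfl

theorem integral_model {𝒳 : Type*} [MeasurableSpace 𝒳] (PX : Measure 𝒳) (η : 𝒳 → ℝ)
    (hη : Measurable η) (h : ∀ x, η x ∈ Set.Ioo (0 : ℝ) 1) (f : 𝒳 × ℝ → ℝ) (hf : Measurable f)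
    (hi : Integrable f (bernoulliModel PX η)) :
    Integrable (fun x => η x * f (x, 1) + (1 - η x) * f (x, -1)) PX ∧
    ∫ z, f z ∂(bernoulliModel PX η) = ∫ x, (η x * f (x, 1) + (1 - η x) * f (x, -1)) ∂PX := by
  rw [model_eq PX η hη] at hi ⊢
  have hi1 := hi.left_of_add_measure
  have hi2 := hi.right_of_add_measure
  rw [integral_add_measure hi1 hi2, integral_map (by fun_prop) hf.aestronglyMeasurable,
    integral_map (by fun_prop) hf.aestronglyMeasurable]
  rw [integrable_map_measure hf.aestronglyMeasurable (by fun_prop)] at hi1 hi2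
  rw [integrable_withDensity_iff_integrable_smul' (by fun_prop) (by simp)] at hi1 hi2
  rw [integral_withDensity_eq_integral_toReal_smul (by fun_prop) (by simp),
    integral_withDensity_eq_integral_toReal_smul (by fun_prop) (by simp)]
  have t1 : ∀ x, (ENNReal.ofReal (η x)).toReal = η x := fun x => ENNReal.toReal_ofReal (h x).1.le
  have t2 : ∀ x, (ENNReal.ofReal (1 - η x)).toReal = 1 - η x :=
    fun x => ENNReal.toReal_ofReal (by linarith [(h x).2])
  simp only [t1, t2, smul_eq_mul, Function.comp_apply] at hi1 hi2 ⊢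
  exact ⟨hi1.add hi2, (integral_add hi1 hi2).symm⟩

/-- the density of `P₁` with respect to `P₀` -/
def dens {𝒳 : Type*} (η₀ η₁ : 𝒳 → ℝ) (z : 𝒳 × ℝ) : ℝ :=
  if z.2 = 1 then η₁ z.1 / η₀ z.1 else (1 - η₁ z.1) / (1 - η₀ z.1)

theorem dens_meas {𝒳 : Type*} [MeasurableSpace 𝒳] (η₀ η₁ : 𝒳 → ℝ) (hη₀ : Measurable η₀)
    (hη₁ : Measurable η₁) : Measurable (dens η₀ η₁) := by
  unfold dens
  exact Measurable.ite (measurable_snd (measurableSet_singleton 1)) (by fun_prop) (by fun_prop)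

theorem model_density {𝒳 : Type*} [MeasurableSpace 𝒳] (PX : Measure 𝒳)
    (η₀ η₁ : 𝒳 → ℝ) (hη₀meas : Measurable η₀) (hη₁meas : Measurable η₁)
    (hη₀ : ∀ x, η₀ x ∈ Set.Ioo (0 : ℝ) 1) :
    bernoulliModel PX η₁ =
      (bernoulliModel PX η₀).withDensity fun z => ENNReal.ofReal (dens η₀ η₁ z) := by
  have hd := dens_meas η₀ η₁ hη₀meas hη₁meas
  refine Measure.ext_of_lintegral _ fun f hf => ?_
  rw [lintegral_withDensity_eq_lintegral_mul _ (by fun_prop) hf, lintegral_model _ _ hη₁meas _ hf,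
    lintegral_model _ _ hη₀meas _ (by fun_prop)]
  refine lintegral_congr fun x => ?_
  obtain ⟨a, b⟩ := hη₀ x
  have b' : 0 < 1 - η₀ x := by linarith
  simp only [Pi.mul_apply, ← mul_assoc]
  rw [← ENNReal.ofReal_mul a.le, ← ENNReal.ofReal_mul b'.le]
  have n : ((-1 : ℝ) = 1) = False := by norm_num
  simp only [dens, n, if_true, if_false]
  rw [mul_div_cancel₀ _ a.ne', mul_div_cancel₀ _ b'.ne']

/-- KL bound between two conditional Bernoulli classification models.
With `h_j = log(η_j/(1-η_j))`,
`∫ [η₁ log(η₁/η₀) + (1-η₁) log((1-η₁)/(1-η₀))] dP_X ≤ (1/8) ∫ (h₁ - h₀)² dP_X`;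
in particular `KL(P₁, P₀) ≤ (1/8) ‖h₁ - h₀‖²_{2,P_X}`. -/
theorem statement_18
    {𝒳 : Type*} [MeasurableSpace 𝒳] (PX : Measure 𝒳) [IsProbabilityMeasure PX]
    (η₀ η₁ : 𝒳 → ℝ) (hη₀meas : Measurable η₀) (hη₁meas : Measurable η₁)
    (hη₀ : ∀ x, η₀ x ∈ Set.Ioo (0 : ℝ) 1) (hη₁ : ∀ x, η₁ x ∈ Set.Ioo (0 : ℝ) 1)
    (h₀ h₁ : 𝒳 → ℝ)
    (hh₀ : ∀ x, h₀ x = Real.log (η₀ x / (1 - η₀ x)))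
    (hh₁ : ∀ x, h₁ x = Real.log (η₁ x / (1 - η₁ x))) :
    (∫⁻ x, ENNReal.ofReal (η₁ x * Real.log (η₁ x / η₀ x) +
        (1 - η₁ x) * Real.log ((1 - η₁ x) / (1 - η₀ x))) ∂PX ≤
      (1 / 8 : ℝ≥0∞) * ∫⁻ x, ENNReal.ofReal ((h₁ x - h₀ x) ^ 2) ∂PX) ∧
    KLdiv (bernoulliModel PX η₁) (bernoulliModel PX η₀) ≤
      (((1 / 8 : ℝ≥0∞) * ∫⁻ x, ENNReal.ofReal ((h₁ x - h₀ x) ^ 2) ∂PX : ℝ≥0∞) : EReal) := by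
  have hpt : ∀ x, η₁ x * Real.log (η₁ x / η₀ x) +
        (1 - η₁ x) * Real.log ((1 - η₁ x) / (1 - η₀ x)) ≤ 1 / 8 * (h₁ x - h₀ x) ^ 2 := by
    intro x
    rw [hh₀, hh₁]
    exact pointwise_aux _ _ (hη₁ x) (hη₀ x)
  have m0 : Measurable h₀ := by
    rw [funext hh₀]; fun_prop
  have m1 : Measurable h₁ := by
    rw [funext hh₁]; fun_prop
  have part1 : (∫⁻ x, ENNReal.ofReal (η₁ x * Real.log (η₁ x / η₀ x) +
        (1 - η₁ x) * Real.log ((1 - η₁ x) / (1 - η₀ x))) ∂PX ≤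
      (1 / 8 : ℝ≥0∞) * ∫⁻ x, ENNReal.ofReal ((h₁ x - h₀ x) ^ 2) ∂PX) := by
    rw [← lintegral_const_mul _ (by fun_prop)]
    refine lintegral_mono fun x => ?_
    have e : (1 / 8 : ℝ≥0∞) = ENNReal.ofReal (1 / 8) := by
      rw [ENNReal.ofReal_div_of_pos (by norm_num)]; simp
    rw [e, ← ENNReal.ofReal_mul (by norm_num)]
    exact ENNReal.ofReal_le_ofReal (hpt x)
  refine ⟨part1, ?_⟩
  by_cases htop : ∫⁻ x, ENNReal.ofReal ((h₁ x - h₀ x) ^ 2) ∂PX = ⊤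
  · rw [htop, ENNReal.mul_top (by simp)]
    exact le_top
  have hd := dens_meas η₀ η₁ hη₀meas hη₁meas
  have hP0 := model_finite PX η₀ hη₀meas hη₀
  have hdens := model_density PX η₀ η₁ hη₀meas hη₁meas hη₀
  have hac : bernoulliModel PX η₁ ≪ bernoulliModel PX η₀ := by
    rw [hdens]; exact withDensity_absolutelyContinuous _ _
  have hrn : (fun z => Real.log (((bernoulliModel PX η₁).rnDeriv (bernoulliModel PX η₀) z).toReal))
      =ᵐ[bernoulliModel PX η₁] fun z => Real.log (dens η₀ η₁ z) := by
    have := Measure.rnDeriv_withDensity (bernoulliModel PX η₀)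
      (f := fun z => ENNReal.ofReal (dens η₀ η₁ z)) (by fun_prop)
    rw [← hdens] at this
    filter_upwards [hac.ae_le this] with z hz
    rw [hz, ENNReal.toReal_ofReal]
    have a0 := hη₀ z.1
    have a1 := hη₁ z.1
    unfold dens
    split_ifs
    · exact div_nonneg a1.1.le a0.1.le
    · exact div_nonneg (by linarith [a1.2]) (by linarith [a0.2])
  have hL2 : Integrable (fun x => (h₁ x - h₀ x) ^ 2) PX := by
    refine ⟨by fun_prop, ?_⟩
    rw [hasFiniteIntegral_iff_ofReal (ae_of_all _ fun x => sq_nonneg _)]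
    exact lt_top_iff_ne_top.2 htop
  have hL1 : Integrable (fun x => h₁ x - h₀ x) PX :=
    ((memLp_two_iff_integrable_sq (by fun_prop)).2 hL2).integrable (by norm_num)
  have n : ((-1 : ℝ) = 1) = False := by norm_num
  have hint : Integrable (fun z => Real.log (dens η₀ η₁ z)) (bernoulliModel PX η₁) := by
    refine ⟨(Real.measurable_log.comp hd).aestronglyMeasurable, ?_⟩
    rw [hasFiniteIntegral_iff_enorm, lintegral_model _ _ hη₁meas _ (by fun_prop)]
    refine lt_of_le_of_lt (lintegral_mono fun x => ?_) (hasFiniteIntegral_iff_enorm.1 hL1.2)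
    have hab := abs_log_aux (η₁ x) (η₀ x) (hη₁ x) (hη₀ x)
    rw [← hh₀, ← hh₁] at hab
    simp only [dens, n, if_true, if_false]
    have a1 := hη₁ x
    calc _ ≤ ENNReal.ofReal (η₁ x) * ‖h₁ x - h₀ x‖ₑ + ENNReal.ofReal (1 - η₁ x) * ‖h₁ x - h₀ x‖ₑ := by
          gcongr
          · exact enorm_le_iff_norm_le.2 hab.1
          · exact enorm_le_iff_norm_le.2 hab.2
      _ = ‖h₁ x - h₀ x‖ₑ := by
          rw [← add_mul, ← ENNReal.ofReal_add a1.1.le (by linarith [a1.2])]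
          simp
  unfold KLdiv
  rw [if_pos ⟨hac, hint.congr hrn.symm⟩, integral_congr_ae hrn]
  obtain ⟨hi, he⟩ := integral_model PX η₁ hη₁meas hη₁ _ (by fun_prop) hint
  rw [he]
  simp only [dens, n, if_true, if_false] at hi ⊢
  have hle := integral_mono hi (hL2.const_mul (1 / 8)) hpt
  rw [integral_const_mul, integral_eq_lintegral_of_nonneg_ae (ae_of_all _ fun x => sq_nonneg _)
    (by fun_prop)] at hle
  have hne : (1 / 8 : ℝ≥0∞) * ∫⁻ x, ENNReal.ofReal ((h₁ x - h₀ x) ^ 2) ∂PX ≠ ⊤ :=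
    ENNReal.mul_ne_top (by simp) htop
  rw [← EReal.coe_toReal (x := (((1 / 8 : ℝ≥0∞) * ∫⁻ x, ENNReal.ofReal ((h₁ x - h₀ x) ^ 2) ∂PX : ℝ≥0∞) : EReal)) 
    (by rwa [Ne, EReal.coe_ennreal_eq_top_iff]) (EReal.coe_ennreal_ne_bot _)]
  rw [EReal.coe_le_coe_iff, EReal.toReal_coe_ennreal, ENNReal.toReal_mul]
  simpa using hle

end PB
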